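/- Let K be a field, m, n positive integers, and M a nonzero representation of the equioriented commutative grid G_{m,n}. Then the following are equivalent: (i) M is thin and indecomposable; (ii) M is a pre-interval representation; (iii) M is isomorphic to the interval representation V_I for some interval I of Fin m × Fin n. -/

import Mathlib

open Classical

structure PRep (K : Type) [Field K] (P : Type) [PartialOrder P] : Type 1 where
  V : P → Type
  [isAddCommGroup : ∀ x, AddCommGroup (V x)]
  [isModule : ∀ x, Module K (V x)]
  [isFinite : ∀ x, Module.Finite K (V x)]
  map : ∀ {x y : P}, x ≤ y → (V x →ₗ[K] V y)
  map_refl : ∀ x : P, map (le_refl x) = LinearMap.id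
  map_trans : ∀ {x y z : P} (hxy : x ≤ y) (hyz : y ≤ z),
    map (le_trans hxy hyz) = (map hyz).comp (map hxy)

attribute [instance] PRep.isAddCommGroup PRep.isModule PRep.isFinite

variable {K : Type} [Field K] {P : Type} [PartialOrder P]

namespace PRep

/-- Isomorphism of representations. -/
def Iso (M N : PRep K P) : Prop :=
  ∃ e : ∀ x : P, M.V x ≃ₗ[K] N.V x,
    ∀ (x y : P) (h : x ≤ y),
      (N.map h).comp (e x : M.V x →ₗ[K] N.V x)
        = (e y : M.V y →ₗ[K] N.V y).comp (M.map h)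

/-- Pointwise direct sum of two representations. -/
def dsum (M N : PRep K P) : PRep K P where
  V x := M.V x × N.V x
  map h := (M.map h).prodMap (N.map h)
  map_refl x := by
    apply LinearMap.ext; intro v
    simp [M.map_refl, N.map_refl]
  map_trans hxy hyz := by
    apply LinearMap.ext; intro v
    simp [M.map_trans hxy hyz, N.map_trans hxy hyz]

def IsThin (M : PRep K P) : Prop := ∀ x : P, Module.finrank K (M.V x) ≤ 1

def supp (M : PRep K P) : Set P := {x : P | Nontrivial (M.V x)}

def Indecomposable (M : PRep K P) : Prop :=
  (∃ x : P, Nontrivial (M.V x)) ∧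
  ∀ N₁ N₂ : PRep K P, M.Iso (N₁.dsum N₂) →
    (∀ x : P, Subsingleton (N₁.V x)) ∨ (∀ x : P, Subsingleton (N₂.V x))

end PRep

/-- Convexity of a subset of a poset. -/
def IsConvexSet (I : Set P) : Prop :=
  ∀ ⦃a b c : P⦄, a ∈ I → c ∈ I → a ≤ b → b ≤ c → b ∈ I

/-- Connectedness of a subset of a poset. -/
def IsConnectedSet (I : Set P) : Prop :=
  ∀ a ∈ I, ∀ b ∈ I,
    Relation.ReflTransGen (fun u v : P => u ∈ I ∧ v ∈ I ∧ (u ≤ v ∨ v ≤ u)) a b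

/-- An interval of a poset: nonempty, convex and connected subset. -/
def IsIntervalSet (I : Set P) : Prop :=
  I.Nonempty ∧ IsConvexSet I ∧ IsConnectedSet I

/-- The interval representation associated to a convex subset `I`. -/
noncomputable def intervalRep (K : Type) [Field K] {P : Type} [PartialOrder P]
    (I : Set P) (hI : IsConvexSet I) : PRep K P where
  V x := ↥(if x ∈ I then (⊤ : Submodule K K) else ⊥)
  map {x y} h :=
    { toFun := fun v => ⟨if y ∈ I then (v : K) else 0, by
        by_cases hy : y ∈ I
        · rw [if_pos hy, if_pos hy]; exact Submodule.mem_top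
        · rw [if_neg hy, if_neg hy]; exact Submodule.zero_mem _⟩
      map_add' := fun v w => by
        apply Subtype.ext
        by_cases hy : y ∈ I <;> simp [hy]
      map_smul' := fun c v => by
        apply Subtype.ext
        by_cases hy : y ∈ I <;> simp [hy] }
  map_refl x := by
    apply LinearMap.ext; intro v
    apply Subtype.ext
    by_cases hx : x ∈ I
    · simp [hx]
    · have hv0 : (v : K) = 0 := (Submodule.mem_bot K).1 (le_of_eq
            (if_neg hx : (if x ∈ I then (⊤ : Submodule K K) else ⊥) = ⊥) v.2)
      show (if x ∈ I then (v : K) else 0) = v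
      exact (if_neg hx).trans hv0.symm
  map_trans {x y z} hxy hyz := by
    apply LinearMap.ext; intro v
    apply Subtype.ext
    by_cases hz : z ∈ I
    · by_cases hy : y ∈ I
      · show (if z ∈ I then (v : K) else 0) = if z ∈ I then (if y ∈ I then (v : K) else 0) else 0
        exact (if_pos hz).trans ((if_pos hz).trans (if_pos hy)).symm
      · by_cases hx : x ∈ I
        · exact absurd (hI hx hz hxy hyz) hy
        · have hv0 : (v : K) = 0 := (Submodule.mem_bot K).1 (le_of_eq
            (if_neg hx : (if x ∈ I then (⊤ : Submodule K K) else ⊥) = ⊥) v.2)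
          simp [hz, hy, hv0]
    · simp [hz]

namespace PRep

def IsPreInterval (M : PRep K P) : Prop :=
  M.IsThin ∧ IsIntervalSet M.supp ∧
    ∀ (x y : P) (h : x ≤ y), x ∈ M.supp → y ∈ M.supp → M.map h ≠ 0

end PRep

/-- A relation `R` on a set `E` lying over a product of two linear orders, such that `R` refines
the order of the base, is reflexive and transitive, lifts intermediate points of the base, and
compares two elements as soon as they share an upper or a lower bound and their images are
comparable. -/
structure IsPlanarCover {E α β : Type} [LinearOrder α] [LinearOrder β]
    (p : E → α × β) (R : E → E → Prop) : Prop where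
  le : ∀ {a b}, R a b → p a ≤ p b
  refl : ∀ a, R a a
  trans : ∀ {a b c}, R a b → R b c → R a c
  of_upper : ∀ {a b c}, R a c → R b c → p a ≤ p b → R a b
  of_lower : ∀ {a b c}, R a b → R a c → p b ≤ p c → R b c
  lift : ∀ {a c}, R a c → ∀ q, p a ≤ q → q ≤ p c → ∃ b, p b = q ∧ R a b ∧ R b c

namespace IsPlanarCover

variable {E α β : Type} [LinearOrder α] [LinearOrder β]
  {p : E → α × β} {R : E → E → Prop}

/-- Comparable elements lying in the same row. -/
def SameRow (p : E → α × β) (R : E → E → Prop) (a b : E) : Prop :=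
  (p a).1 = (p b).1 ∧ (R a b ∨ R b a)

/-- `b` is reached from `a` by a horizontal move, an upward vertical move and a horizontal move. -/
def Step (p : E → α × β) (R : E → E → Prop) (a b : E) : Prop :=
  ∃ c d, SameRow p R a c ∧ (p c).2 = (p d).2 ∧ R c d ∧ SameRow p R d b

lemma SameRow.symm {E α β : Type} {p : E → α × β} {R : E → E → Prop} {a b : E}
    (h : SameRow p R a b) : SameRow p R b a :=
  ⟨h.1.symm, h.2.symm⟩

lemma sameRow_refl (hR : IsPlanarCover p R) (a : E) : SameRow p R a a :=
  ⟨rfl, Or.inl (hR.refl a)⟩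

lemma le_or_le_of_fst_eq {a b : E} (h : (p a).1 = (p b).1) : p a ≤ p b ∨ p b ≤ p a :=
  (le_total (p a).2 (p b).2).imp (fun h' => ⟨h.le, h'⟩) (fun h' => ⟨h.ge, h'⟩)

lemma sameRow_trans (hR : IsPlanarCover p R) {a b c : E}
    (hab : SameRow p R a b) (hbc : SameRow p R b c) : SameRow p R a c := by
  refine ⟨hab.1.trans hbc.1, ?_⟩
  have hac := le_or_le_of_fst_eq (hab.1.trans hbc.1)
  rcases hab.2 with h | h <;> rcases hbc.2 with h' | h'
  · exact Or.inl (hR.trans h h')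
  · exact hac.imp (hR.of_upper h h') (hR.of_upper h' h)
  · exact hac.imp (hR.of_lower h h') (hR.of_lower h' h)
  · exact Or.inr (hR.trans h' h)

lemma sameRow_of_upper (hR : IsPlanarCover p R) {a b c : E} (h : (p a).1 = (p b).1)
    (ha : R a c) (hb : R b c) : SameRow p R a b :=
  ⟨h, (le_or_le_of_fst_eq h).imp (hR.of_upper ha hb) (hR.of_upper hb ha)⟩

lemma sameRow_of_lower (hR : IsPlanarCover p R) {a b c : E} (h : (p a).1 = (p b).1)
    (ha : R c a) (hb : R c b) : SameRow p R a b :=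
  ⟨h, (le_or_le_of_fst_eq h).imp (hR.of_lower ha hb) (hR.of_lower hb ha)⟩

lemma step_of_rel (hR : IsPlanarCover p R) {a b : E} (h : R a b) : Step p R a b := by
  obtain ⟨c, hc, hac, hcb⟩ := hR.lift h ((p b).1, (p a).2)
    ⟨(hR.le h).1, le_rfl⟩ ⟨le_rfl, (hR.le h).2⟩
  exact ⟨a, c, hR.sameRow_refl a, by rw [hc], hac, by rw [hc], Or.inl hcb⟩

lemma step_of_common_target (hR : IsPlanarCover p R) {x y z : E}
    (hx : Step p R x y) (hz : Step p R z y) : Step p R x z ∨ Step p R z x := by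
  obtain ⟨a, b, hxa, hab, rab, hby⟩ := hx
  obtain ⟨c, d, hzc, hcd, rcd, hdy⟩ := hz
  have key : ∀ {x z a b c d : E}, SameRow p R x a → (p a).2 = (p b).2 → R a b →
      SameRow p R z c → R c d → SameRow p R b d →
      (p a).1 ≤ (p c).1 → Step p R x z := by
    intro x z a b c d hxa hab rab hzc rcd hbd hac
    obtain ⟨e, he, rae, reb⟩ := hR.lift rab ((p c).1, (p a).2) ⟨hac, le_rfl⟩
      ⟨(hR.le rcd).1.trans hbd.1.ge, hab.le⟩
    have hec : (p e).1 = (p c).1 := by rw [he]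
    refine ⟨a, e, hxa, by rw [he], rae, hR.sameRow_trans ?_ hzc.symm⟩
    rcases hbd.2 with h | h
    · exact hR.sameRow_of_upper hec (hR.trans reb h) rcd
    · exact hR.sameRow_of_upper hec reb (hR.trans rcd h)
  have hbd := hR.sameRow_trans hby hdy.symm
  exact (le_total (p a).1 (p c).1).imp
    (key hxa hab rab hzc rcd hbd) (key hzc hcd rcd hxa rab hbd.symm)

lemma step_of_common_source (hR : IsPlanarCover p R) {x y z : E}
    (hx : Step p R y x) (hz : Step p R y z) : Step p R x z ∨ Step p R z x := by
  obtain ⟨a, b, hya, hab, rab, hbx⟩ := hx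
  obtain ⟨c, d, hyc, hcd, rcd, hdz⟩ := hz
  have key : ∀ {x z a b c d : E}, R a b → SameRow p R b x → (p c).2 = (p d).2 → R c d →
      SameRow p R d z → SameRow p R a c → (p b).1 ≤ (p d).1 → Step p R x z := by
    intro x z a b c d rab hbx hcd rcd hdz hac hbd
    obtain ⟨e, he, rce, red⟩ := hR.lift rcd ((p b).1, (p c).2)
      ⟨hac.1.ge.trans (hR.le rab).1, le_rfl⟩ ⟨hbd, hcd.le⟩
    have hbe : (p b).1 = (p e).1 := by rw [he]
    refine ⟨e, d, hR.sameRow_trans hbx.symm ?_, by rw [he, hcd], red, hdz⟩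
    rcases hac.2 with h | h
    · exact hR.sameRow_of_lower hbe rab (hR.trans h rce)
    · exact hR.sameRow_of_lower hbe (hR.trans h rab) rce
  have hac := hR.sameRow_trans hya.symm hyc
  exact (le_total (p b).1 (p d).1).imp
    (key rab hbx hcd rcd hdz hac) (key rcd hdz hab rab hbx hac.symm)

open Relation in
lemma chain_of_chain_of_step_target (hR : IsPlanarCover p R) {x y : E}
    (h : ReflTransGen (Step p R) x y) : ∀ {z}, Step p R z y →
    ReflTransGen (Step p R) x z ∨ ReflTransGen (Step p R) z x := by
  induction h with
  | refl => exact fun hz => Or.inr (.single hz)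
  | tail hxw hwy ih =>
    intro z hz
    rcases hR.step_of_common_target hwy hz with h | h
    · exact Or.inl (hxw.tail h)
    · exact ih h

open Relation in
lemma chain_of_chain_of_step_source (hR : IsPlanarCover p R) {x y : E}
    (h : ReflTransGen (Step p R) y x) : ∀ {z}, Step p R y z →
    ReflTransGen (Step p R) x z ∨ ReflTransGen (Step p R) z x := by
  induction h using ReflTransGen.head_induction_on with
  | refl => exact fun hz => Or.inl (.single hz)
  | head hyw hwx ih =>
    intro z hz
    rcases hR.step_of_common_source hyw hz with h | h
    · exact ih h
    · exact Or.inr (hwx.head h)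

open Relation in
lemma chain_or_chain_of_eqvGen (hR : IsPlanarCover p R) {x y : E} (h : EqvGen R x y) :
    ReflTransGen (Step p R) x y ∨ ReflTransGen (Step p R) y x := by
  rw [← EqvGen.reflTransGen_symmGen] at h
  induction h with
  | refl => exact Or.inl .refl
  | tail _ hyz ih =>
    rcases hyz with hyz | hyz <;> have hs := hR.step_of_rel hyz <;> rcases ih with ih | ih
    · exact Or.inl (ih.tail hs)
    · exact hR.chain_of_chain_of_step_source ih hs
    · exact hR.chain_of_chain_of_step_target ih hs
    · exact Or.inr (ih.head hs)

lemma Step.fst_le (hR : IsPlanarCover p R) {x y : E} (h : Step p R x y) : (p x).1 ≤ (p y).1 := by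
  obtain ⟨a, b, hxa, -, rab, hby⟩ := h
  exact hxa.1.le.trans ((hR.le rab).1.trans hby.1.le)

open Relation in
/-- A chain of upward moves yields a relation towards everything that lies above its source and
in the row of its target. -/
lemma rel_of_chain (hR : IsPlanarCover p R) {x y : E} (h : ReflTransGen (Step p R) x y) :
    (p x).1 ≤ (p y).1 ∧ ∀ {w}, SameRow p R y w → p x ≤ p w → R x w := by
  induction h with
  | refl =>
    refine ⟨le_rfl, fun hw hle => hw.2.elim id fun h => hR.of_upper (hR.refl _) h hle⟩
  | @tail y z _ hyz ih =>
    refine ⟨ih.1.trans (Step.fst_le hR hyz), fun {w} hw hle => ?_⟩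
    obtain ⟨a, b, hya, hab, rab, hbz⟩ := hyz
    have hxa : (p x).1 ≤ (p a).1 := ih.1.trans hya.1.le
    have hbw := hR.sameRow_trans hbz hw
    rcases le_total (p x).2 (p a).2 with hle' | hle'
    · have rxa : R x a := ih.2 hya ⟨hxa, hle'⟩
      rcases hbw.2 with h | h
      · exact hR.trans rxa (hR.trans rab h)
      · exact hR.of_upper (hR.trans rxa rab) h hle
    · have hbw' : p b ≤ p w := ⟨hbw.1.le, hab.ge.trans (hle'.trans hle.2)⟩
      have rbw : R b w := hbw.2.elim id fun h => hR.of_upper (hR.refl _) h hbw'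
      obtain ⟨e, he, rae, rew⟩ := hR.lift (hR.trans rab rbw) ((p a).1, (p w).2)
        ⟨le_rfl, hle'.trans hle.2⟩ ⟨(hR.le rab).1.trans hbw.1.le, le_rfl⟩
      have hae : SameRow p R a e := ⟨by rw [he], Or.inl rae⟩
      exact hR.trans (ih.2 (hR.sameRow_trans hya hae) (by rw [he]; exact ⟨hxa, hle.2⟩)) rew

open Relation in
lemma sameRow_of_chain (hR : IsPlanarCover p R) {x y : E} (h : ReflTransGen (Step p R) x y)
    (hyx : (p y).1 ≤ (p x).1) : SameRow p R x y := by
  induction h with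
  | refl => exact hR.sameRow_refl x
  | @tail y z hxy hyz ih =>
    have h₁ := (hR.rel_of_chain hxy).1
    have hyx' := (Step.fst_le hR hyz).trans hyx
    refine hR.sameRow_trans (ih hyx') ?_
    obtain ⟨a, b, hya, -, rab, hbz⟩ := hyz
    have hab : (p a).1 = (p b).1 :=
      le_antisymm (hR.le rab).1 (hbz.1.le.trans (hyx.trans (h₁.trans hya.1.le)))
    exact hR.sameRow_trans hya (hR.sameRow_trans ⟨hab, Or.inl rab⟩ hbz)

/-- Elements of one connected component are related as soon as their images are comparable. -/
theorem rel_of_eqvGen (hR : IsPlanarCover p R) {x y : E} (h : Relation.EqvGen R x y)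
    (hle : p x ≤ p y) : R x y := by
  rcases hR.chain_or_chain_of_eqvGen h with h | h
  · exact (hR.rel_of_chain h).2 (hR.sameRow_refl y) hle
  · exact (hR.sameRow_of_chain h hle.1).2.elim
      (fun h' => hR.of_upper (hR.refl _) h' hle) id

end IsPlanarCover

namespace PRep

lemma exists_smul_eq_of_finrank_le_one {V : Type} [AddCommGroup V] [Module K V]
    [Module.Finite K V] (h : Module.finrank K V ≤ 1) {v : V} (hv : v ≠ 0) (w : V) :
    ∃ c : K, c • v = w := by
  have : Nontrivial V := ⟨v, 0, hv⟩
  exact (finrank_eq_one_iff_of_nonzero' v hv).1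
    (le_antisymm h (Module.finrank_pos (R := K) (M := V))) w

lemma IsThin.exists_smul_eq {M : PRep K P} (hM : M.IsThin) {x : P} {v : M.V x} (hv : v ≠ 0)
    (w : M.V x) : ∃ c : K, c • v = w :=
  exists_smul_eq_of_finrank_le_one (hM x) hv w

lemma IsThin.eq_of_map_eq {M : PRep K P} (hM : M.IsThin) {x y : P} (h : x ≤ y) {v w : M.V x}
    (hv : M.map h v ≠ 0) (hvw : M.map h v = M.map h w) : v = w := by
  have hv0 : v ≠ 0 := fun h0 => hv (by rw [h0, map_zero])
  obtain ⟨c, hc⟩ := hM.exists_smul_eq hv0 w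
  rw [← hc, map_smul] at hvw
  have : (1 - c) • M.map h v = 0 := by rw [sub_smul, one_smul, ← hvw, sub_self]
  have hc1 : 1 - c = 0 := (smul_eq_zero.1 this).resolve_right hv
  rw [← hc, ← sub_eq_zero.1 hc1, one_smul]

lemma map_map (M : PRep K P) {x y z : P} (hxy : x ≤ y) (hyz : y ≤ z) (v : M.V x) :
    M.map hyz (M.map hxy v) = M.map (hxy.trans hyz) v := by
  rw [M.map_trans hxy hyz]; rfl

lemma map_self (M : PRep K P) {x : P} (h : x ≤ x) (v : M.V x) : M.map h v = v := by
  rw [M.map_refl]; rfl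

/-- The nonzero vectors of a representation. -/
structure Vec (M : PRep K P) : Type where
  pt : P
  vec : M.V pt
  ne_zero : vec ≠ 0

/-- `a` is sent to `b` by the representation. -/
def Vec.Rel {M : PRep K P} (a b : M.Vec) : Prop :=
  ∃ h : a.pt ≤ b.pt, M.map h a.vec = b.vec

lemma isPlanarCover_rel {α β : Type} [LinearOrder α] [LinearOrder β] {M : PRep K (α × β)}
    (hM : M.IsThin) : IsPlanarCover (Vec.pt : M.Vec → α × β) Vec.Rel where
  le h := h.1
  refl a := ⟨le_rfl, M.map_self _ _⟩
  trans := by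
    rintro a b c ⟨hab, h₁⟩ ⟨hbc, h₂⟩
    exact ⟨hab.trans hbc, by rw [← h₂, ← h₁, M.map_map]⟩
  of_upper := by
    rintro a b c ⟨hac, h₁⟩ ⟨hbc, h₂⟩ hab
    have h₃ : M.map hbc (M.map hab a.vec) = c.vec := by rw [M.map_map, h₁]
    exact ⟨hab, hM.eq_of_map_eq hbc (h₃ ▸ c.ne_zero) (h₃.trans h₂.symm)⟩
  of_lower := by
    rintro a b c ⟨hab, h₁⟩ ⟨hac, h₂⟩ hbc
    exact ⟨hbc, by rw [← h₁, ← h₂, M.map_map]⟩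
  lift := by
    rintro a c ⟨hac, h⟩ q haq hqc
    have hq : M.map hqc (M.map haq a.vec) = c.vec := by rw [M.map_map, h]
    exact ⟨⟨q, M.map haq a.vec, fun h0 => c.ne_zero (by rw [← hq, h0, map_zero])⟩, rfl,
      ⟨haq, rfl⟩, ⟨hqc, hq⟩⟩

lemma mem_supp_of_ne_zero {M : PRep K P} {x : P} {v : M.V x} (hv : v ≠ 0) : x ∈ M.supp :=
  ⟨v, 0, hv⟩

lemma coe_eq_zero_of_notMem {P : Type} {I : Set P} {x : P}
    (c : ↥(if x ∈ I then (⊤ : Submodule K K) else ⊥)) (hx : x ∉ I) : (c : K) = 0 := by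
  obtain ⟨c, hc⟩ := c
  rw [if_neg hx] at hc
  exact hc

lemma iso_of_symm_natural {M N : PRep K P} (f : ∀ x, N.V x ≃ₗ[K] M.V x)
    (hf : ∀ (x y : P) (h : x ≤ y) (c : N.V x), f y (N.map h c) = M.map h (f x c)) :
    M.Iso N := by
  refine ⟨fun x => (f x).symm, fun x y h => LinearMap.ext fun w => (f y).injective ?_⟩
  simp [hf]

/-- A thin representation with a compatible choice of generators is an interval
representation. -/
lemma iso_intervalRep_of_section {M : PRep K P} (hM : M.IsThin) (v : ∀ x, M.V x)
    (hv : ∀ x ∈ M.supp, v x ≠ 0)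
    (hmap : ∀ (x y : P) (h : x ≤ y), x ∈ M.supp → y ∈ M.supp → M.map h (v x) = v y)
    (hI : IsConvexSet M.supp) : M.Iso (intervalRep K M.supp hI) := by
  let f : ∀ x, (intervalRep K M.supp hI).V x →ₗ[K] M.V x := fun x =>
    (LinearMap.toSpanSingleton K (M.V x) (v x)).comp
      (Submodule.subtype (if x ∈ M.supp then (⊤ : Submodule K K) else ⊥))
  have hf : ∀ x, Function.Bijective (f x) := by
    intro x
    by_cases hx : x ∈ M.supp
    · constructor
      · intro c d hcd
        exact Subtype.ext (smul_left_injective K (hv x hx) hcd)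
      · intro w
        obtain ⟨c, hc⟩ := hM.exists_smul_eq (hv x hx) w
        exact ⟨⟨c, by rw [if_pos hx]; trivial⟩, hc⟩
    · have hsub : Subsingleton (M.V x) := not_nontrivial_iff_subsingleton.1 hx
      refine ⟨fun c d _ => Subtype.ext ?_, fun w => ⟨0, Subsingleton.elim _ _⟩⟩
      rw [coe_eq_zero_of_notMem c hx, coe_eq_zero_of_notMem d hx]
  refine iso_of_symm_natural (fun x => LinearEquiv.ofBijective (f x) (hf x)) ?_
  intro x y h (c : ↥(if x ∈ M.supp then (⊤ : Submodule K K) else ⊥))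
  change (if y ∈ M.supp then (c : K) else 0) • v y = M.map h ((c : K) • v x)
  by_cases hy : y ∈ M.supp
  · by_cases hx : x ∈ M.supp
    · rw [if_pos hy, map_smul, hmap x y h hx hy]
    · rw [coe_eq_zero_of_notMem c hx]; simp
  · have hsub : Subsingleton (M.V y) := not_nontrivial_iff_subsingleton.1 hy
    exact Subsingleton.elim _ _

/-- A thin representation over a product of two linear orders, all of whose support is met by one
connected component of nonzero vectors, is an interval representation. -/
lemma isInterval_of_component {α β : Type} [LinearOrder α] [LinearOrder β]
    {M : PRep K (α × β)} (hM : M.IsThin) (e : M.Vec)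
    (he : ∀ x ∈ M.supp, ∃ a : M.Vec, a.pt = x ∧ Relation.EqvGen Vec.Rel e a) :
    ∃ hI : IsIntervalSet M.supp, M.Iso (intervalRep K M.supp hI.2.1) := by
  have he' : ∀ x, ∃ v : M.V x, x ∈ M.supp → ∃ hv : v ≠ 0,
      Relation.EqvGen Vec.Rel e ⟨x, v, hv⟩ := by
    intro x
    by_cases hx : x ∈ M.supp
    · obtain ⟨⟨_, v, hv⟩, rfl, h⟩ := he x hx
      exact ⟨v, fun _ => ⟨hv, h⟩⟩
    · exact ⟨0, fun h => absurd h hx⟩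
  choose v hv hev using he'
  have hmap : ∀ (x y : α × β) (h : x ≤ y), x ∈ M.supp → y ∈ M.supp → M.map h (v x) = v y := by
    intro x y h hx hy
    exact ((isPlanarCover_rel hM).rel_of_eqvGen
      (((hev x hx).symm _ _).trans _ _ _ (hev y hy)) h).2
  have hconv : IsConvexSet M.supp := by
    intro a b c ha hc hab hbc
    refine mem_supp_of_ne_zero (v := M.map hab (v a)) fun h0 => hv c hc ?_
    rw [← hmap a c (hab.trans hbc) ha hc, ← M.map_map hab hbc, h0, map_zero]
  have hconn : IsConnectedSet M.supp := by
    intro x hx y hy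
    have h := ((hev x hx).symm _ _).trans _ _ _ (hev y hy)
    rw [← Relation.EqvGen.reflTransGen_symmGen] at h
    refine h.lift Vec.pt fun a b hab => ⟨mem_supp_of_ne_zero a.ne_zero,
      mem_supp_of_ne_zero b.ne_zero, hab.imp (fun h => h.1) (fun h => h.1)⟩
  exact ⟨⟨⟨e.pt, mem_supp_of_ne_zero e.ne_zero⟩, hconv, hconn⟩,
    iso_intervalRep_of_section hM v hv hmap hconv⟩

/-- The subrepresentation given by a family of subspaces stable under the structure maps. -/
def sub (M : PRep K P) (A : ∀ x, Submodule K (M.V x))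
    (hA : ∀ (x y : P) (h : x ≤ y), ∀ v ∈ A x, M.map h v ∈ A y) : PRep K P where
  V x := A x
  map {x y} h := (M.map h).restrict (hA x y h)
  map_refl _ := LinearMap.ext fun v => Subtype.ext (M.map_self le_rfl v.1)
  map_trans hxy hyz := LinearMap.ext fun v => Subtype.ext (M.map_map hxy hyz v.1).symm

lemma iso_dsum_sub (M : PRep K P) (A B : ∀ x, Submodule K (M.V x))
    (hA : ∀ (x y : P) (h : x ≤ y), ∀ v ∈ A x, M.map h v ∈ A y)
    (hB : ∀ (x y : P) (h : x ≤ y), ∀ v ∈ B x, M.map h v ∈ B y)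
    (hAB : ∀ x, IsCompl (A x) (B x)) : M.Iso ((M.sub A hA).dsum (M.sub B hB)) := by
  refine iso_of_symm_natural (fun x => Submodule.prodEquivOfIsCompl (A x) (B x) (hAB x)) ?_
  rintro x y h ⟨⟨a, _⟩, ⟨b, _⟩⟩
  exact (map_add (M.map h) a b).symm

/-- In an indecomposable representation, a subset of the support that no nonzero structure map
leaves or enters is empty or everything. -/
lemma Indecomposable.supp_subset {M : PRep K P} (hM : M.Indecomposable) (S : Set P)
    (hS : ∀ (x y : P) (h : x ≤ y), M.map h ≠ 0 → (x ∈ S ↔ y ∈ S))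
    {x₀ : P} (hx₀ : x₀ ∈ S) (hx₀' : x₀ ∈ M.supp) : M.supp ⊆ S := by
  have stable : ∀ T : Set P, (∀ (x y : P) (h : x ≤ y), M.map h ≠ 0 → x ∈ T → y ∈ T) →
      ∀ (x y : P) (h : x ≤ y), ∀ v ∈ (if x ∈ T then (⊤ : Submodule K (M.V x)) else ⊥),
        M.map h v ∈ (if y ∈ T then (⊤ : Submodule K (M.V y)) else ⊥) := by
    intro T hT x y h v hv
    by_cases h0 : M.map h v = 0
    · rw [h0]; exact Submodule.zero_mem _
    · have hx : x ∈ T := by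
        by_contra hx
        rw [if_neg hx, Submodule.mem_bot] at hv
        exact h0 (by rw [hv, map_zero])
      rw [if_pos (hT x y h (fun h' => h0 (by rw [h']; rfl)) hx)]
      trivial
  have hiso := M.iso_dsum_sub _ _ (stable S fun x y h h0 => (hS x y h h0).1)
    (stable Sᶜ fun x y h h0 hx hy => hx ((hS x y h h0).2 hy)) (fun x => by
      by_cases hx : x ∈ S
      · simpa [hx] using isCompl_top_bot
      · simpa [hx] using isCompl_bot_top)
  have top_of_mem : ∀ (T : Set P) (x : P), x ∈ T → x ∈ M.supp →
      ¬ Subsingleton ↥(if x ∈ T then (⊤ : Submodule K (M.V x)) else ⊥) := by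
    intro T x hxT hx h
    rw [if_pos hxT, Submodule.subsingleton_iff_eq_bot] at h
    have : Nontrivial (M.V x) := hx
    exact top_ne_bot h
  rcases hM.2 _ _ hiso with h | h
  · exact absurd (h x₀) (top_of_mem S x₀ hx₀ hx₀')
  · intro x hx
    by_contra hxS
    exact top_of_mem Sᶜ x hxS hx (h x)

lemma Indecomposable.exists_interval {α β : Type} [LinearOrder α] [LinearOrder β]
    {M : PRep K (α × β)} (hthin : M.IsThin) (hM : M.Indecomposable) :
    ∃ hI : IsIntervalSet M.supp, M.Iso (intervalRep K M.supp hI.2.1) := by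
  obtain ⟨x₀, hx₀⟩ := hM.1
  obtain ⟨v₀, hv₀⟩ := exists_ne (0 : M.V x₀)
  let e : M.Vec := ⟨x₀, v₀, hv₀⟩
  refine isInterval_of_component hthin e ?_
  refine hM.supp_subset {x | ∃ a : M.Vec, a.pt = x ∧ Relation.EqvGen Vec.Rel e a} ?_
    (x₀ := x₀) ⟨e, rfl, .refl _⟩ hx₀
  intro x y h h0
  obtain ⟨w, hw⟩ : ∃ w, M.map h w ≠ 0 := by
    by_contra! hall
    exact h0 (LinearMap.ext hall)
  constructor
  · rintro ⟨⟨_, v, hv⟩, rfl, ha⟩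
    have hv' : M.map h v ≠ 0 := by
      obtain ⟨c, rfl⟩ := hthin.exists_smul_eq hv w
      intro hz
      exact hw (by rw [map_smul, hz, smul_zero])
    exact ⟨⟨y, M.map h v, hv'⟩, rfl, ha.trans _ _ _ (.rel _ _ ⟨h, rfl⟩)⟩
  · rintro ⟨⟨_, v, hv⟩, rfl, ha⟩
    obtain ⟨c, hc⟩ := hthin.exists_smul_eq hw v
    rw [← map_smul] at hc
    refine ⟨⟨x, c • w, fun hz => hv ?_⟩, rfl,
      ha.trans _ _ _ (.symm _ _ (.rel _ _ ⟨h, hc⟩))⟩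
    rw [← hc, hz, map_zero]

lemma IsPreInterval.map_ne_zero {M : PRep K P} (hM : M.IsPreInterval) {x y : P} (h : x ≤ y)
    (hx : x ∈ M.supp) (hy : y ∈ M.supp) {v : M.V x} (hv : v ≠ 0) : M.map h v ≠ 0 := by
  intro hz
  refine hM.2.2 x y h hx hy (LinearMap.ext fun w => ?_)
  obtain ⟨c, rfl⟩ := hM.1.exists_smul_eq hv w
  rw [map_smul, hz, smul_zero]
  rfl

lemma IsPreInterval.exists_interval {α β : Type} [LinearOrder α] [LinearOrder β]
    {M : PRep K (α × β)} (hM : M.IsPreInterval) :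
    ∃ hI : IsIntervalSet M.supp, M.Iso (intervalRep K M.supp hI.2.1) := by
  obtain ⟨x₀, hx₀⟩ := hM.2.1.1
  have : Nontrivial (M.V x₀) := hx₀
  obtain ⟨v₀, hv₀⟩ := exists_ne (0 : M.V x₀)
  refine isInterval_of_component hM.1 ⟨x₀, v₀, hv₀⟩ fun x hx => ?_
  have hpath := hM.2.1.2.2 x₀ hx₀ x hx
  clear hx
  induction hpath with
  | refl => exact ⟨_, rfl, .refl _⟩
  | @tail y z _ hyz ih =>
    obtain ⟨⟨_, v, hv⟩, rfl, ha⟩ := ih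
    obtain ⟨hy, hz, h | h⟩ := hyz
    · exact ⟨⟨z, M.map h v, hM.map_ne_zero h hy hz hv⟩, rfl,
        ha.trans _ _ _ (.rel _ _ ⟨h, rfl⟩)⟩
    · have : Nontrivial (M.V z) := hz
      obtain ⟨w, hw⟩ := exists_ne (0 : M.V z)
      obtain ⟨c, hc⟩ := hM.1.exists_smul_eq (hM.map_ne_zero h hz hy hw) v
      rw [← map_smul] at hc
      refine ⟨⟨z, c • w, fun h0 => hv ?_⟩, rfl,
        ha.trans _ _ _ (.symm _ _ (.rel _ _ ⟨h, hc⟩))⟩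
      rw [← hc, h0, map_zero]

lemma isPreInterval_of_iso_intervalRep {M : PRep K P} {I : Set P} (hI : IsIntervalSet I)
    (hiso : M.Iso (intervalRep K I hI.2.1)) : M.IsPreInterval := by
  obtain ⟨e, he⟩ := hiso
  have hone : ∀ {x}, x ∈ I → (1 : K) ∈ (if x ∈ I then (⊤ : Submodule K K) else ⊥) := by
    intro x hx
    rw [if_pos hx]
    trivial
  have hsupp : M.supp = I := by
    ext x
    constructor
    · intro hx
      by_contra hxI
      have : Nontrivial (M.V x) := hx
      obtain ⟨v, hv⟩ := exists_ne (0 : M.V x)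
      exact hv ((e x).map_eq_zero_iff.1 (Subtype.ext (coe_eq_zero_of_notMem (e x v) hxI)))
    · intro hx
      refine mem_supp_of_ne_zero (v := (e x).symm ⟨1, hone hx⟩) fun h0 => ?_
      exact one_ne_zero (congrArg Subtype.val ((e x).symm.map_eq_zero_iff.1 h0))
  refine ⟨fun x => ?_, hsupp ▸ hI, fun x y h hx hy h0 => ?_⟩
  · rw [(e x).finrank_eq]
    exact (Submodule.finrank_le (if x ∈ I then (⊤ : Submodule K K) else ⊥)).trans_eq
      (Module.finrank_self K)
  · rw [hsupp] at hx hy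
    let u : (intervalRep K I hI.2.1).V x := ⟨1, hone hx⟩
    have h₁ := LinearMap.congr_fun (he x y h) ((e x).symm u)
    rw [h0] at h₁
    have h₂ : (intervalRep K I hI.2.1).map h u = 0 := by
      simpa only [LinearMap.comp_apply, LinearEquiv.coe_coe, LinearEquiv.apply_symm_apply,
        LinearMap.zero_apply, map_zero] using h₁
    have h₃ : (if y ∈ I then (1 : K) else 0) = 0 := congrArg Subtype.val h₂
    rw [if_pos hy] at h₃
    exact one_ne_zero h₃

lemma IsThin.subsingleton_or_of_iso_dsum {M N₁ N₂ : PRep K P} (hM : M.IsThin)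
    (hiso : M.Iso (N₁.dsum N₂)) (x : P) : Subsingleton (N₁.V x) ∨ Subsingleton (N₂.V x) := by
  obtain ⟨e, -⟩ := hiso
  have h : Module.finrank K (N₁.V x × N₂.V x) ≤ 1 := (e x).finrank_eq.symm.trans_le (hM x)
  rw [Module.finrank_prod] at h
  rcases Nat.eq_zero_or_pos (Module.finrank K (N₁.V x)) with h₁ | h₁
  · exact Or.inl ((Module.finrank_zero_iff (R := K)).1 h₁)
  · exact Or.inr ((Module.finrank_zero_iff (R := K)).1 (by omega))

lemma IsPreInterval.indecomposable {M : PRep K P} (hM : M.IsPreInterval) :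
    M.Indecomposable := by
  refine ⟨hM.2.1.1, fun N₁ N₂ hiso => ?_⟩
  have hor := hM.1.subsingleton_or_of_iso_dsum hiso
  obtain ⟨e, he⟩ := hiso
  have hsum : ∀ {x}, x ∈ M.supp → Subsingleton (N₁.V x) → ¬ Subsingleton (N₂.V x) := by
    intro x hx h₁ h₂
    have : Nontrivial (M.V x) := hx
    have : Subsingleton ((N₁.dsum N₂).V x) := inferInstanceAs (Subsingleton (N₁.V x × N₂.V x))
    exact not_subsingleton (M.V x) ((e x).toEquiv.subsingleton)
  have hmap : ∀ {x y : P} (h : x ≤ y), x ∈ M.supp → y ∈ M.supp →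
      (Subsingleton (N₁.V x) ↔ Subsingleton (N₁.V y)) := by
    intro x y h hx hy
    have hcross : ¬ ((Subsingleton (N₁.V x) ∧ Subsingleton (N₂.V y)) ∨
        (Subsingleton (N₂.V x) ∧ Subsingleton (N₁.V y))) := by
      intro hc
      refine hM.2.2 x y h hx hy (LinearMap.ext fun v => (e y).map_eq_zero_iff.1 ?_)
      have h₁ := LinearMap.congr_fun (he x y h) v
      refine h₁.symm.trans ?_
      change (N₁.map h (e x v).1, N₂.map h (e x v).2) = (0, 0)
      rcases hc with ⟨_, _⟩ | ⟨_, _⟩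
      · rw [Subsingleton.elim (e x v).1 0, map_zero, Subsingleton.elim (N₂.map h _) 0]
      · rw [Subsingleton.elim (e x v).2 0, map_zero, Subsingleton.elim (N₁.map h _) 0]
    have := hor x
    have := hor y
    tauto
  by_contra! hne
  obtain ⟨⟨x, hx⟩, ⟨y, hy⟩⟩ := hne
  rw [← not_subsingleton_iff_nontrivial] at hx hy
  have mem : ∀ z, (¬ Subsingleton (N₁.V z) ∨ ¬ Subsingleton (N₂.V z)) → z ∈ M.supp := by
    intro z hz
    by_contra hzs
    have : Subsingleton (M.V z) := not_nontrivial_iff_subsingleton.1 hzs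
    have : Subsingleton (N₁.V z × N₂.V z) := (e z).symm.toEquiv.subsingleton
    exact hz.elim (fun h => h ((Prod.fst_surjective (β := N₂.V z)).subsingleton))
      (fun h => h ((Prod.snd_surjective (α := N₁.V z)).subsingleton))
  have hpath := hM.2.1.2.2 x (mem x (Or.inl hx)) y (mem y (Or.inr hy))
  have hy₁ : ¬ Subsingleton (N₁.V y) := by
    clear hy
    induction hpath with
    | refl => exact hx
    | tail _ hyz ih =>
      obtain ⟨hy, hz, h | h⟩ := hyz
      · rwa [← hmap h hy hz]
      · rwa [hmap h hz hy]
  exact (hor y).elim hy₁ hy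

end PRep

/-- For a nonzero representation `M` of the equioriented
commutative grid `G_{m,n}`, the following are equivalent: (i) `M` is thin and
indecomposable; (ii) `M` is pre-interval; (iii) `M` is isomorphic to the
interval representation `V_I` for some interval `I`. -/
theorem thin_indec_iff_preinterval_iff_interval (K : Type) [Field K] (m n : ℕ)
    (hm : 0 < m) (hn : 0 < n) (M : PRep K (Fin m × Fin n))
    (hM : ∃ x, Nontrivial (M.V x)) :
    ((M.IsThin ∧ M.Indecomposable) ↔ M.IsPreInterval) ∧
    (M.IsPreInterval ↔
      ∃ (I : Set (Fin m × Fin n)) (hI : IsIntervalSet I),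
        M.Iso (intervalRep K I hI.2.1)) := by
  have hpre : M.IsThin ∧ M.Indecomposable → M.IsPreInterval := fun h => by
    obtain ⟨hI, hiso⟩ := h.2.exists_interval h.1
    exact PRep.isPreInterval_of_iso_intervalRep hI hiso
  refine ⟨⟨hpre, fun h => ⟨h.1, h.indecomposable⟩⟩, fun h => ⟨_, h.exists_interval⟩, ?_⟩
  rintro ⟨I, hI, hiso⟩
  exact PRep.isPreInterval_of_iso_intervalRep hI hiso
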